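/- If L is a σ-exposed family of segments in ℝ^d (σ ∈ (0,1)), then L has density O(σ^{−2d−2}): every ball of radius r intersects at most O(σ^{−2d−2}) segments of L of length at least 2r. -/

import Mathlib

/-- An object `A` `σ`-shadows an object `B` if every point of `B` is within distance
`σ · diam B` of `A`. -/
def Shadows {X : Type*} [MetricSpace X] (σ : ℝ) (A B : Set X) : Prop :=
  ∀ p ∈ B, Metric.infDist p A ≤ σ * Metric.diam B

open MeasureTheory Metric Module in
/-- Volume packing bound for a `δ`-separated family in the unit ball. -/
theorem packing_bound {F ι : Type*} [NormedAddCommGroup F] [NormedSpace ℝ F]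
    [FiniteDimensional ℝ F] (s : Finset ι) (f : ι → F) (δ : ℝ) (hδ : 0 < δ)
    (hs : ∀ i ∈ s, ‖f i‖ ≤ 1)
    (h : ∀ i ∈ s, ∀ j ∈ s, i ≠ j → 2 * δ ≤ ‖f i - f j‖) :
    (s.card : ℝ) * δ ^ finrank ℝ F ≤ (1 + δ) ^ finrank ℝ F := by
  borelize F
  let μ : Measure F := Measure.addHaar
  have ρpos : 0 < 1 + δ := by linarith
  set A := ⋃ i ∈ s, ball (f i) δ with hA
  have D : Set.PairwiseDisjoint (s : Set ι) (fun i => ball (f i) δ) := by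
    rintro i hi j hj hij
    apply ball_disjoint_ball
    rw [dist_eq_norm]
    have := h i hi j hj hij
    linarith
  have A_subset : A ⊆ ball (0 : F) (1 + δ) := by
    refine Set.iUnion₂_subset fun i hi => ?_
    apply ball_subset_ball'
    rw [dist_zero_right]
    linarith [hs i hi]
  have I : (s.card : ENNReal) * ENNReal.ofReal (δ ^ finrank ℝ F) * μ (ball 0 1) ≤
      ENNReal.ofReal ((1 + δ) ^ finrank ℝ F) * μ (ball 0 1) :=
    calc
      (s.card : ENNReal) * ENNReal.ofReal (δ ^ finrank ℝ F) * μ (ball 0 1) = μ A := by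
        rw [hA, measure_biUnion_finset D fun c _ => measurableSet_ball]
        simp only [μ.addHaar_ball_of_pos _ hδ]
        simp only [Finset.sum_const, nsmul_eq_mul, mul_assoc]
      _ ≤ μ (ball (0 : F) (1 + δ)) := measure_mono A_subset
      _ = ENNReal.ofReal ((1 + δ) ^ finrank ℝ F) * μ (ball 0 1) := by
        simp only [μ.addHaar_ball_of_pos _ ρpos]
  have J : (s.card : ENNReal) * ENNReal.ofReal (δ ^ finrank ℝ F) ≤
      ENNReal.ofReal ((1 + δ) ^ finrank ℝ F) :=
    (ENNReal.mul_le_mul_iff_left (measure_ball_pos _ _ zero_lt_one).ne' measure_ball_lt_top.ne).1 I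
  have := ENNReal.toReal_le_of_le_ofReal (pow_nonneg ρpos.le _) J
  rw [ENNReal.toReal_mul, ENNReal.toReal_ofReal (pow_nonneg hδ.le _)] at this
  simpa using this

/-- Two segments with close parameters: the longer one shadows the shorter one. -/
theorem shadows_of_close {E : Type*} [NormedAddCommGroup E] [NormedSpace ℝ E]
    (σ : ℝ) (hσ : 0 < σ) (a b a' b' c u u' : E) (r t t' l l' : ℝ) (hr : 0 < r)
    (ht : t ∈ Set.Icc (0 : ℝ) 1) (ht' : t' ∈ Set.Icc (0 : ℝ) 1)
    (hl' : 2 * r ≤ l') (hll : l' ≤ l) (hu : b - a = l • u) (hu' : b' - a' = l' • u')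
    (hd : l' = dist a' b')
    (h1 : ‖r⁻¹ • (a + t • (b - a) - c) - r⁻¹ • (a' + t' • (b' - a') - c)‖ ≤ σ / 3)
    (h2 : ‖u - u'‖ ≤ σ / 3) (h3 : ‖t - t'‖ ≤ σ / 3) (hu1 : ‖u‖ ≤ 1) :
    Shadows σ (segment ℝ a b) (segment ℝ a' b') := by
  intro q' hq'
  rw [segment_eq_image'] at hq'
  obtain ⟨τ, ⟨hτ0, hτ1⟩, rfl⟩ := hq'
  obtain ⟨ht0, ht1⟩ := ht
  obtain ⟨ht0', ht1'⟩ := ht'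
  have hl'0 : 0 < l' := by linarith
  have hl0 : 0 < l := by linarith
  set lam := l' / l with hlam
  have hlam0 : 0 ≤ lam := by positivity
  have hlam1 : lam ≤ 1 := by rw [hlam, div_le_one hl0]; exact hll
  have hlaml : lam * l = l' := by rw [hlam]; field_simp
  set θ := (1 - lam) * t + lam * τ with hθ
  have hmem : a + θ • (b - a) ∈ segment ℝ a b := by
    rw [segment_eq_image']
    refine ⟨θ, ⟨?_, ?_⟩, rfl⟩
    · have := mul_nonneg (sub_nonneg.2 hlam1) ht0
      have := mul_nonneg hlam0 hτ0
      linarith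
    · have := mul_le_mul_of_nonneg_left ht1 (sub_nonneg.2 hlam1)
      have := mul_le_mul_of_nonneg_left hτ1 hlam0
      linarith
  have hdiam : l' ≤ Metric.diam (segment ℝ a' b') := by
    rw [hd]
    refine Metric.dist_le_diam_of_mem ?_ (left_mem_segment ℝ a' b') (right_mem_segment ℝ a' b')
    rw [segment_eq_image']
    exact (isCompact_Icc.image (by fun_prop)).isBounded
  refine (Metric.infDist_le_dist_of_mem hmem).trans ?_
  refine le_trans ?_ (mul_le_mul_of_nonneg_left hdiam hσ.le)
  have key : a' + τ • (b' - a') - (a + θ • (b - a)) =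
      -((a + t • (b - a) - c) - (a' + t' • (b' - a') - c)) + (l' * (t - t')) • u
        - ((τ - t') * l') • (u - u') := by
    have hth : θ * l = t * l + (τ - t) * l' := by
      rw [hθ, ← hlaml]; ring
    rw [hu, hu', smul_smul, smul_smul, smul_smul, smul_smul, hth]
    module
  have e1 : ‖(a + t • (b - a) - c) - (a' + t' • (b' - a') - c)‖ ≤ r * (σ / 3) := by
    rw [← smul_sub, norm_smul, norm_inv, Real.norm_of_nonneg hr.le, inv_mul_le_iff₀ hr] at h1
    exact h1
  have e2 : ‖(l' * (t - t')) • u‖ ≤ l' * (σ / 3) := by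
    rw [norm_smul, norm_mul, Real.norm_of_nonneg hl'0.le, mul_assoc]
    refine mul_le_mul_of_nonneg_left ?_ hl'0.le
    calc ‖t - t'‖ * ‖u‖ ≤ ‖t - t'‖ * 1 := mul_le_mul_of_nonneg_left hu1 (norm_nonneg _)
      _ ≤ σ / 3 := by linarith
  have e3 : ‖((τ - t') * l') • (u - u')‖ ≤ l' * (σ / 3) := by
    rw [norm_smul, norm_mul, Real.norm_of_nonneg hl'0.le, mul_comm ‖τ - t'‖, mul_assoc]
    refine mul_le_mul_of_nonneg_left ?_ hl'0.le
    have : ‖τ - t'‖ ≤ 1 := by rw [Real.norm_eq_abs, abs_le]; constructor <;> linarith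
    calc ‖τ - t'‖ * ‖u - u'‖ ≤ 1 * ‖u - u'‖ := mul_le_mul_of_nonneg_right this (norm_nonneg _)
      _ ≤ σ / 3 := by linarith
  rw [dist_eq_norm, key]
  refine (norm_sub_le _ _).trans ?_
  have := norm_add_le (-((a + t • (b - a) - c) - (a' + t' • (b' - a') - c)))
    ((l' * (t - t')) • u)
  rw [norm_neg] at this
  have : r * (σ / 3) ≤ l' * (σ / 3) := mul_le_mul_of_nonneg_right (by linarith) (by positivity)
  linarith

/-- A `σ`-exposed family of segments in `ℝ^d` has density `O(σ^(−2d−2))`: every ball of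
radius `r > 0` intersects at most `O(σ^(−2d−2))` segments of the family of length `≥ 2r`. -/
theorem stmt12 (d : ℕ) :
    ∃ C : ℝ, 0 < C ∧
      ∀ (σ : ℝ), 0 < σ → σ < 1 →
      ∀ (n : ℕ) (a b : Fin n → EuclideanSpace ℝ (Fin d)),
        (∀ i j, i ≠ j → ¬ Shadows σ (segment ℝ (a i) (b i)) (segment ℝ (a j) (b j))) →
        ∀ (c : EuclideanSpace ℝ (Fin d)) (r : ℝ), 0 < r →
        ∀ s : Finset (Fin n),
          (∀ i ∈ s, (segment ℝ (a i) (b i) ∩ Metric.closedBall c r).Nonempty ∧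
            2 * r ≤ dist (a i) (b i)) →
          (s.card : ℝ) ≤ C / σ ^ (2 * d + 2) := by
  refine ⟨7 ^ (2 * d + 1), by positivity, ?_⟩
  intro σ hσ hσ1 n a b hexp c r hr s hs
  have hex : ∀ i, ∃ t : ℝ, i ∈ s → t ∈ Set.Icc (0 : ℝ) 1 ∧
      ‖a i + t • (b i - a i) - c‖ ≤ r := by
    intro i
    by_cases hi : i ∈ s
    · obtain ⟨⟨q, hq, hqc⟩, -⟩ := hs i hi
      rw [segment_eq_image'] at hq
      obtain ⟨t, ht, rfl⟩ := hq
      exact ⟨t, fun _ => ⟨ht, by rwa [Metric.mem_closedBall, dist_eq_norm] at hqc⟩⟩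
    · exact ⟨0, fun h => absurd h hi⟩
  choose t ht using hex
  let l : Fin n → ℝ := fun i => dist (a i) (b i)
  let u : Fin n → EuclideanSpace ℝ (Fin d) := fun i => (l i)⁻¹ • (b i - a i)
  have hl0 : ∀ i ∈ s, 0 < l i := fun i hi => by
    have := (hs i hi).2
    change 0 < dist (a i) (b i)
    linarith
  have hu : ∀ i ∈ s, b i - a i = l i • u i := fun i hi => by
    simp only [u]
    rw [smul_smul, mul_inv_cancel₀ (hl0 i hi).ne', one_smul]
  have hu1 : ∀ i ∈ s, ‖u i‖ ≤ 1 := fun i hi => by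
    simp only [u]
    rw [norm_smul, norm_inv, Real.norm_of_nonneg (hl0 i hi).le, ← dist_eq_norm, dist_comm,
      inv_mul_cancel₀ (hl0 i hi).ne']
  let f : Fin n → EuclideanSpace ℝ (Fin d) × EuclideanSpace ℝ (Fin d) × ℝ := fun i =>
    (r⁻¹ • (a i + t i • (b i - a i) - c), u i, t i)
  have hf1 : ∀ i ∈ s, ‖f i‖ ≤ 1 := by
    intro i hi
    obtain ⟨⟨h0, h1⟩, h2⟩ := ht i hi
    refine norm_prod_le_iff.2 ⟨?_, norm_prod_le_iff.2 ⟨hu1 i hi, ?_⟩⟩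
    · change ‖r⁻¹ • (a i + t i • (b i - a i) - c)‖ ≤ 1
      rw [norm_smul, norm_inv, Real.norm_of_nonneg hr.le, inv_mul_le_iff₀ hr, mul_one]
      exact h2
    · change ‖t i‖ ≤ 1
      rw [Real.norm_of_nonneg h0]
      exact h1
  have key : ∀ i ∈ s, ∀ j ∈ s, i ≠ j → l j ≤ l i → σ / 3 ≤ ‖f i - f j‖ := by
    intro i hi j hj hij hle
    by_contra! hlt
    have h := norm_prod_le_iff.1 hlt.le
    have h' := norm_prod_le_iff.1 h.2
    exact hexp i j hij (shadows_of_close σ hσ (a i) (b i) (a j) (b j) c (u i) (u j) r (t i) (t j)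
      (l i) (l j) hr (ht i hi).1 (ht j hj).1 (hs j hj).2 hle (hu i hi) (hu j hj) rfl
      h.1 h'.1 h'.2 (hu1 i hi))
  have hsep : ∀ i ∈ s, ∀ j ∈ s, i ≠ j → 2 * (σ / 6) ≤ ‖f i - f j‖ := by
    intro i hi j hj hij
    rcases le_total (l j) (l i) with hle | hle
    · linarith [key i hi j hj hij hle]
    · rw [norm_sub_rev]
      linarith [key j hj i hi hij.symm hle]
  have hp := packing_bound s f (σ / 6) (by positivity) hf1 hsep
  have hfr : Module.finrank ℝ
      (EuclideanSpace ℝ (Fin d) × EuclideanSpace ℝ (Fin d) × ℝ) = 2 * d + 1 := by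
    simp [Module.finrank_prod]; ring
  rw [hfr] at hp
  have hp2 : (s.card : ℝ) * (σ / 6) ^ (2 * d + 1) ≤ (7 / 6) ^ (2 * d + 1) :=
    hp.trans (pow_le_pow_left₀ (by positivity) (by linarith) _)
  rw [div_pow, div_pow, mul_div_assoc', div_le_div_iff_of_pos_right (by positivity)] at hp2
  rw [le_div_iff₀ (by positivity)]
  refine le_trans (mul_le_mul_of_nonneg_left ?_ (Nat.cast_nonneg _)) hp2
  exact pow_le_pow_of_le_one hσ.le hσ1.le (by omega)
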